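/- arXiv:1508.06062 — 2 statements merged into one kernel-verified Lean document; each statement's English description precedes it below -/
import Mathlib

section
/- There exists a distance d₁ on the Heisenberg group ℍ that is biLipschitz equivalent to d_b (there is C ≥ 1 with C⁻¹·d_b ≤ d₁ ≤ C·d_b), is left-invariant (d₁(g·p, g·q) = d₁(p, q) for all g, p, q ∈ ℍ), and such that no blow-up of d₁ is self-similar: whenever λ_j → 0 and q_j ∈ ℍ are sequences such that the functions (p₁,p₂) ↦ (1/λ_j)·d₁(q_j·δ_{λ_j}(p₁), q_j·δ_{λ_j}(p₂)) converge pointwise to a function ρ, there is no λ > 1 with ρ(δ_λ(p), δ_λ(q)) = λ·ρ(p,q) for all p, q ∈ ℍ. -/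
open scoped ENNReal

namespace Heis

/-- The underlying set of the Heisenberg group: `ℝ³`. -/
abbrev H : Type := ℝ × ℝ × ℝ

/-- Heisenberg group multiplication. -/
noncomputable def Hmul (p q : H) : H :=
  (p.1 + q.1, p.2.1 + q.2.1, p.2.2 + q.2.2 + (p.1 * q.2.1 - p.2.1 * q.1) / 2)

/-- Heisenberg group inverse. -/
def Hinv (p : H) : H := (-p.1, -p.2.1, -p.2.2)

/-- The box norm `‖p‖ = max {|x|, |y|, √|z|}`. -/
noncomputable def boxNorm (p : H) : ℝ :=
  max |p.1| (max |p.2.1| (Real.sqrt |p.2.2|))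

/-- The box distance `d_b(p,q) = ‖p⁻¹·q‖`. -/
noncomputable def dbox (p q : H) : ℝ := boxNorm (Hmul (Hinv p) q)

/-- The dilations `δ_λ(x,y,z) = (λx, λy, λ²z)`. -/
noncomputable def dil (lam : ℝ) (p : H) : H := (lam * p.1, lam * p.2.1, lam ^ 2 * p.2.2)

/-- `d` is a distance (metric) on `X`. -/
def IsDistance {X : Type*} (d : X → X → ℝ) : Prop :=
  (∀ x y, d x y = d y x) ∧ (∀ x, d x x = 0) ∧
  (∀ x y, d x y = 0 → x = y) ∧ (∀ x y z, d x z ≤ d x y + d y z)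

/-- The open ball of the distance function `d`. -/
def ballOf {X : Type*} (d : X → X → ℝ) (x : X) (r : ℝ) : Set X := {y | d x y < r}

/-- The (extended) diameter of a set with respect to a distance function `d`. -/
noncomputable def ediamOf {X : Type*} (d : X → X → ℝ) (E : Set X) : ℝ≥0∞ :=
  ⨆ (x ∈ E) (y ∈ E), ENNReal.ofReal (d x y)

/-- The Hausdorff `Q`-measure of `A` with respect to the distance function `d`:
`H^Q_d(A) = lim_{ε→0} inf { Σᵢ (diam Eᵢ)^Q : A ⊆ ⋃ᵢ Eᵢ, diam Eᵢ ≤ ε }`. -/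
noncomputable def hausdorffOf {X : Type*} (d : X → X → ℝ) (Q : ℝ) (A : Set X) : ℝ≥0∞ :=
  ⨆ (ε : ℝ≥0∞) (_ : 0 < ε),
    ⨅ (E : ℕ → Set X) (_ : A ⊆ ⋃ n, E n) (_ : ∀ n, ediamOf d (E n) ≤ ε),
      ∑' n, ediamOf d (E n) ^ Q

/-- `(X, d)` is Ahlfors `Q`-regular: there is `C ≥ 1` with
`C⁻¹ r^Q ≤ H^Q_d(B_d(x,r)) ≤ C r^Q` for all `x` and `0 < r < diam X`. -/
def AhlforsRegularOf {X : Type*} (d : X → X → ℝ) (Q : ℝ) : Prop :=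
  ∃ C : ℝ, 1 ≤ C ∧ ∀ (x : X) (r : ℝ), 0 < r → ENNReal.ofReal r < ediamOf d Set.univ →
    ENNReal.ofReal (C⁻¹ * r ^ Q) ≤ hausdorffOf d Q (ballOf d x r) ∧
    hausdorffOf d Q (ballOf d x r) ≤ ENNReal.ofReal (C * r ^ Q)

/-- The distances `d` and `ρ` are biLipschitz equivalent on the set `A`. -/
def BiLipOn {X : Type*} (d ρ : X → X → ℝ) (A : Set X) : Prop :=
  ∃ L : ℝ, 1 ≤ L ∧ ∀ x ∈ A, ∀ y ∈ A, L⁻¹ * ρ x y ≤ d x y ∧ d x y ≤ L * ρ x y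


/-- The modulated square `r² (6 + sin (log r + a) + sin (√2 log r + b))`. -/
noncomputable def modSq (a b r : ℝ) : ℝ :=
  r ^ 2 * (6 + Real.sin (Real.log r + a) + Real.sin (√2 * Real.log r + b))

lemma modSq_zero (a b : ℝ) : modSq a b 0 = 0 := by simp [modSq]

lemma four_mul_sq_le_modSq (a b r : ℝ) : 4 * r ^ 2 ≤ modSq a b r := by
  unfold modSq
  nlinarith [sq_nonneg r, Real.neg_one_le_sin (Real.log r + a),
    Real.neg_one_le_sin (√2 * Real.log r + b)]

lemma modSq_le_eight_mul_sq (a b r : ℝ) : modSq a b r ≤ 8 * r ^ 2 := by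
  unfold modSq
  nlinarith [sq_nonneg r, Real.sin_le_one (Real.log r + a),
    Real.sin_le_one (√2 * Real.log r + b)]

lemma modSq_add_of_le (a b : ℝ) {r s : ℝ} (hs : 0 < s) (hsr : s ≤ r) :
    modSq a b r + modSq a b s + r * s ≤ modSq a b (r + s) := by
  have hr : 0 < r := hs.trans_le hsr
  have hD : 0 ≤ Real.log (r + s) - Real.log r :=
    sub_nonneg.2 (Real.log_le_log hr (by linarith))
  have hD' : r * (Real.log (r + s) - Real.log r) ≤ s := by
    rw [← Real.log_div (by positivity) hr.ne']
    have := Real.log_le_sub_one_of_pos (show 0 < (r + s) / r by positivity)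
    calc r * Real.log ((r + s) / r) ≤ r * ((r + s) / r - 1) := by gcongr
      _ = s := by field_simp; ring
  have h2 : √2 ≤ 2 := Real.sqrt_le_iff.2 ⟨by norm_num, by norm_num⟩
  have h1 := (abs_le.1 (Real.abs_sin_sub_sin_le (Real.log (r + s) + a) (Real.log r + a))).1
  rw [add_sub_add_right_eq_sub, abs_of_nonneg hD] at h1
  have h3 := (abs_le.1 (Real.abs_sin_sub_sin_le (√2 * Real.log (r + s) + b)
    (√2 * Real.log r + b))).1
  rw [add_sub_add_right_eq_sub, ← mul_sub, abs_of_nonneg (by positivity)] at h3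
  have h4 : √2 * (Real.log (r + s) - Real.log r) ≤ 2 * (Real.log (r + s) - Real.log r) := by
    gcongr
  unfold modSq
  have l1 := Real.neg_one_le_sin (Real.log (r + s) + a)
  have l2 := Real.neg_one_le_sin (√2 * Real.log (r + s) + b)
  have u1 := Real.sin_le_one (Real.log s + a)
  have u2 := Real.sin_le_one (√2 * Real.log s + b)
  set D := Real.log (r + s) - Real.log r
  set A := Real.sin (Real.log (r + s) + a)
  set B := Real.sin (√2 * Real.log (r + s) + b)
  set A' := Real.sin (Real.log r + a)
  set B' := Real.sin (√2 * Real.log r + b)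
  set A'' := Real.sin (Real.log s + a)
  set B'' := Real.sin (√2 * Real.log s + b)
  have k1 : -(3 * (r * s)) ≤ r ^ 2 * (A + B - A' - B') := by
    have : r ^ 2 * (-(3 * D)) ≤ r ^ 2 * (A + B - A' - B') := by
      gcongr; linarith
    nlinarith
  have k2 : (2 * (r * s) + s ^ 2) * (-2) ≤ (2 * (r * s) + s ^ 2) * (A + B) := by
    gcongr; linarith
  have k3 : s ^ 2 * (A'' + B'') ≤ s ^ 2 * 2 := by
    gcongr; linarith
  have k4 : s ^ 2 ≤ r * s := by nlinarith
  nlinarith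

lemma modSq_add (a b : ℝ) {r s : ℝ} (hr : 0 ≤ r) (hs : 0 ≤ s) :
    modSq a b r + modSq a b s + r * s ≤ modSq a b (r + s) := by
  rcases hr.eq_or_lt with rfl | hr
  · simp [modSq_zero]
  rcases hs.eq_or_lt with rfl | hs
  · simp [modSq_zero]
  rcases le_total s r with h | h
  · exact modSq_add_of_le a b hs h
  · have := modSq_add_of_le a b hr h
    rw [add_comm r s]
    linarith

lemma strictMonoOn_modSq (a b : ℝ) : StrictMonoOn (modSq a b) (Set.Ici 0) := by
  intro r hr s _ hrs
  have h := modSq_add a b (r := r) (s := s - r) hr (by linarith)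
  rw [add_sub_cancel] at h
  have h' := four_mul_sq_le_modSq a b (s - r)
  have : 0 < (s - r) ^ 2 := pow_pos (by linarith) 2
  have : 0 ≤ r * (s - r) := mul_nonneg hr (by linarith)
  linarith

lemma exists_modSq_eq (a b : ℝ) {z : ℝ} (hz : 0 ≤ z) : ∃ r, 0 ≤ r ∧ modSq a b r = z := by
  rcases hz.eq_or_lt with rfl | hz
  · exact ⟨0, le_rfl, modSq_zero a b⟩
  have hpos : 0 < √(z / 8) := Real.sqrt_pos.2 (by positivity)
  have hcont : ContinuousOn (modSq a b) (Set.Icc √(z / 8) √(z / 4)) := by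
    have : ContinuousOn Real.log (Set.Icc √(z / 8) √(z / 4)) :=
      Real.continuousOn_log.mono fun x hx => (hpos.trans_le hx.1).ne'
    unfold modSq
    fun_prop
  have hle : √(z / 8) ≤ √(z / 4) := Real.sqrt_le_sqrt (by linarith)
  have h1 := modSq_le_eight_mul_sq a b √(z / 8)
  have h2 := four_mul_sq_le_modSq a b √(z / 4)
  rw [Real.sq_sqrt (by positivity)] at h1 h2
  obtain ⟨r, hr, hrz⟩ := intermediate_value_Icc hle hcont
    (show z ∈ Set.Icc _ _ from ⟨by linarith, by linarith⟩)
  exact ⟨r, hpos.le.trans hr.1, hrz⟩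

/-- The inverse of `modSq 0 0` on the nonnegative reals. -/
noncomputable def modSqrt (z : ℝ) : ℝ := (exists_modSq_eq 0 0 (abs_nonneg z)).choose

lemma modSqrt_nonneg (z : ℝ) : 0 ≤ modSqrt z :=
  (exists_modSq_eq 0 0 (abs_nonneg z)).choose_spec.1

lemma modSq_modSqrt (z : ℝ) : modSq 0 0 (modSqrt z) = |z| :=
  (exists_modSq_eq 0 0 (abs_nonneg z)).choose_spec.2

lemma modSqrt_le_iff (z : ℝ) {r : ℝ} (hr : 0 ≤ r) : modSqrt z ≤ r ↔ |z| ≤ modSq 0 0 r := by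
  rw [← modSq_modSqrt z]
  exact ((strictMonoOn_modSq 0 0).le_iff_le (modSqrt_nonneg z) hr).symm

/-- The homogeneous-type norm whose vertical part is modulated by `modSqrt`. -/
noncomputable def modNorm (p : H) : ℝ := max |p.1| (max |p.2.1| (modSqrt p.2.2))

lemma modNorm_nonneg (p : H) : 0 ≤ modNorm p := (abs_nonneg _).trans (le_max_left _ _)

lemma modNorm_le_iff (p : H) {r : ℝ} (hr : 0 ≤ r) :
    modNorm p ≤ r ↔ |p.1| ≤ r ∧ |p.2.1| ≤ r ∧ |p.2.2| ≤ modSq 0 0 r := by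
  simp only [modNorm, max_le_iff, modSqrt_le_iff _ hr]

lemma boxNorm_nonneg (p : H) : 0 ≤ boxNorm p := (abs_nonneg _).trans (le_max_left _ _)

lemma boxNorm_le_iff (p : H) {r : ℝ} (hr : 0 ≤ r) :
    boxNorm p ≤ r ↔ |p.1| ≤ r ∧ |p.2.1| ≤ r ∧ |p.2.2| ≤ r ^ 2 := by
  simp only [boxNorm, max_le_iff, Real.sqrt_le_left hr]

lemma modNorm_le_boxNorm (p : H) : modNorm p ≤ boxNorm p := by
  obtain ⟨h1, h2, h3⟩ := (boxNorm_le_iff p (boxNorm_nonneg p)).1 le_rfl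
  refine (modNorm_le_iff p (boxNorm_nonneg p)).2 ⟨h1, h2, ?_⟩
  nlinarith [four_mul_sq_le_modSq 0 0 (boxNorm p)]

lemma boxNorm_le_three_mul_modNorm (p : H) : boxNorm p ≤ 3 * modNorm p := by
  have h0 := modNorm_nonneg p
  obtain ⟨h1, h2, h3⟩ := (modNorm_le_iff p h0).1 le_rfl
  refine (boxNorm_le_iff p (by positivity)).2 ⟨by linarith, by linarith, ?_⟩
  nlinarith [modSq_le_eight_mul_sq 0 0 (modNorm p)]

lemma modNorm_Hmul_le (p q : H) : modNorm (Hmul p q) ≤ modNorm p + modNorm q := by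
  have hp := modNorm_nonneg p
  have hq := modNorm_nonneg q
  obtain ⟨p1, p2, p3⟩ := (modNorm_le_iff p hp).1 le_rfl
  obtain ⟨q1, q2, q3⟩ := (modNorm_le_iff q hq).1 le_rfl
  refine (modNorm_le_iff _ (by positivity)).2
    ⟨(abs_add_le _ _).trans (add_le_add p1 q1), (abs_add_le _ _).trans (add_le_add p2 q2), ?_⟩
  have h1 : |p.1 * q.2.1| ≤ modNorm p * modNorm q := by
    rw [abs_mul]; gcongr
  have h2 : |p.2.1 * q.1| ≤ modNorm p * modNorm q := by
    rw [abs_mul]; gcongr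
  have h3 := modSq_add 0 0 hp hq
  simp only [Hmul]
  rw [abs_le] at *
  constructor <;> linarith

lemma modNorm_Hinv (p : H) : modNorm (Hinv p) = modNorm p := by
  apply le_antisymm
  · refine (modNorm_le_iff _ (modNorm_nonneg p)).2 ?_
    simpa [Hinv] using (modNorm_le_iff p (modNorm_nonneg p)).1 le_rfl
  · refine (modNorm_le_iff _ (modNorm_nonneg _)).2 ?_
    simpa [Hinv] using (modNorm_le_iff (Hinv p) (modNorm_nonneg _)).1 le_rfl

lemma modNorm_zero : modNorm (0, 0, 0) = 0 :=
  le_antisymm ((modNorm_le_iff _ le_rfl).2 (by simp [modSq_zero])) (modNorm_nonneg _)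

lemma eq_zero_of_modNorm_eq_zero {p : H} (h : modNorm p = 0) : p = (0, 0, 0) := by
  have := (modNorm_le_iff p le_rfl).1 h.le
  simp only [modSq_zero, abs_nonpos_iff] at this
  exact Prod.ext this.1 (Prod.ext this.2.1 this.2.2)

/-- The left-invariant distance associated with `modNorm`. -/
noncomputable def modDist (p q : H) : ℝ := modNorm (Hmul (Hinv p) q)

lemma isDistance_modDist : IsDistance modDist := by
  refine ⟨fun p q => ?_, fun p => ?_, fun p q h => ?_, fun p q r => ?_⟩
  · rw [modDist, ← modNorm_Hinv, modDist]
    congr 1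
    ext <;> simp only [Hmul, Hinv] <;> ring
  · rw [modDist, ← modNorm_zero]
    congr 1
    ext <;> simp only [Hmul, Hinv] <;> ring
  · have h := eq_zero_of_modNorm_eq_zero h
    simp only [Hmul, Hinv, Prod.mk.injEq] at h
    obtain ⟨h1, h2, h3⟩ := h
    have e1 : p.1 = q.1 := by linarith
    have e2 : p.2.1 = q.2.1 := by linarith
    rw [e1, e2] at h3
    exact Prod.ext e1 (Prod.ext e2 (by linarith))
  · refine le_trans (le_of_eq ?_) (modNorm_Hmul_le _ _)
    rw [modDist]
    congr 1
    ext <;> simp only [Hmul, Hinv] <;> ring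

lemma modDist_Hmul_left (g p q : H) : modDist (Hmul g p) (Hmul g q) = modDist p q := by
  unfold modDist
  congr 1
  ext <;> simp only [Hmul, Hinv] <;> ring

lemma modSq_mul (a b : ℝ) {l r : ℝ} (hl : 0 < l) (hr : 0 < r) :
    modSq a b (l * r) = l ^ 2 * modSq (a + Real.log l) (b + √2 * Real.log l) r := by
  unfold modSq
  rw [Real.log_mul hl.ne' hr.ne']
  ring_nf

lemma exists_mem_Icc_sub_int_mul_two_pi (x : ℝ) :
    ∃ y ∈ Set.Icc 0 (2 * Real.pi), ∃ n : ℤ, y = x - n * (2 * Real.pi) := by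
  have hpi := Real.two_pi_pos
  refine ⟨x - ⌊x / (2 * Real.pi)⌋ * (2 * Real.pi), ⟨?_, ?_⟩, _, rfl⟩
  · have := (le_div_iff₀ hpi).1 (Int.floor_le (x / (2 * Real.pi)))
    linarith
  · have := (div_lt_iff₀ hpi).1 (Int.lt_floor_add_one (x / (2 * Real.pi)))
    linarith

lemma modSq_sub_int_mul_two_pi (a b r : ℝ) (m n : ℤ) :
    modSq (a - m * (2 * Real.pi)) (b - n * (2 * Real.pi)) r = modSq a b r := by
  unfold modSq
  rw [← add_sub_assoc, ← add_sub_assoc, Real.sin_sub_int_mul_two_pi,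
    Real.sin_sub_int_mul_two_pi]

/-- The phases of `modSq` range over a compact torus. -/
lemma exists_subseq_tendsto_modSq (a b : ℕ → ℝ) :
    ∃ α β : ℝ, ∃ φ : ℕ → ℕ, StrictMono φ ∧ ∀ r,
      Filter.Tendsto (fun j => modSq (a (φ j)) (b (φ j)) r) Filter.atTop
        (nhds (modSq α β r)) := by
  choose a' ha' m hm using fun j => exists_mem_Icc_sub_int_mul_two_pi (a j)
  choose b' hb' n hn using fun j => exists_mem_Icc_sub_int_mul_two_pi (b j)
  obtain ⟨⟨α, β⟩, -, φ, hφ, hlim⟩ :=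
    (isCompact_Icc.prod isCompact_Icc).tendsto_subseq
      (x := fun j => (a' j, b' j)) fun j => Set.mk_mem_prod (ha' j) (hb' j)
  refine ⟨α, β, φ, hφ, fun r => ?_⟩
  have hcont : Continuous fun c : ℝ × ℝ => modSq c.1 c.2 r := by
    unfold modSq
    fun_prop
  refine ((hcont.tendsto (α, β)).comp hlim).congr fun j => ?_
  simp only [Function.comp_apply, hm, hn, modSq_sub_int_mul_two_pi]

/-- A sum of two sines with frequencies `1` and `√2` has no nonzero period. -/
lemma eq_zero_of_periodic_sin_add_sin {a b T : ℝ}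
    (h : ∀ u, Real.sin (u + T + a) + Real.sin (√2 * (u + T) + b) =
      Real.sin (u + a) + Real.sin (√2 * u + b)) : T = 0 := by
  have hs : √2 * √2 = 2 := Real.mul_self_sqrt (by norm_num)
  have sub_eq (x y : ℝ) : Real.sin (x + 2 * y) - Real.sin x =
      2 * Real.sin y * Real.cos (x + y) := by
    rw [Real.sin_sub_sin]
    ring_nf
  obtain ⟨n, hn⟩ : ∃ n : ℤ, n * (2 * Real.pi) = √2 * T := by
    rw [← Real.cos_eq_one_iff]
    have hne : Real.sin (√2 * Real.pi) ≠ 0 := by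
      rw [Real.sin_ne_zero_iff]
      exact fun n hn => irrational_sqrt_two.ne_int n
        (mul_right_cancel₀ Real.pi_ne_zero hn.symm)
    obtain ⟨u, hu⟩ : ∃ u, √2 * u + b + √2 * Real.pi = 0 :=
      ⟨-(b + √2 * Real.pi) / √2, by field_simp; ring⟩
    have h1 := h u
    have h2 := h (u + 2 * Real.pi)
    rw [show u + 2 * Real.pi + T + a = u + T + a + 2 * Real.pi by ring,
      show u + 2 * Real.pi + a = u + a + 2 * Real.pi by ring,
      Real.sin_add_two_pi, Real.sin_add_two_pi,
      show √2 * (u + 2 * Real.pi + T) + b = √2 * (u + T) + b + 2 * (√2 * Real.pi) by ring,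
      show √2 * (u + 2 * Real.pi) + b = √2 * u + b + 2 * (√2 * Real.pi) by ring] at h2
    have h3 := sub_eq (√2 * (u + T) + b) (√2 * Real.pi)
    have h4 := sub_eq (√2 * u + b) (√2 * Real.pi)
    rw [hu, Real.cos_zero] at h4
    rw [show √2 * (u + T) + b + √2 * Real.pi = √2 * T by linear_combination hu] at h3
    have h5 : 2 * Real.sin (√2 * Real.pi) * Real.cos (√2 * T) =
      2 * Real.sin (√2 * Real.pi) * 1 := by linarith
    exact mul_left_cancel₀ (by positivity) h5
  obtain ⟨m, hm⟩ : ∃ m : ℤ, m * (2 * Real.pi) = T := by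
    rw [← Real.cos_eq_one_iff]
    have hne : Real.sin (√2 * Real.pi / 2) ≠ 0 := by
      rw [Real.sin_ne_zero_iff]
      refine fun n hn => irrational_sqrt_two.ne_int (2 * n)
        (mul_right_cancel₀ Real.pi_ne_zero ?_)
      push_cast
      linarith
    obtain ⟨u, hu⟩ : ∃ u, u + a + √2 * Real.pi / 2 = 0 :=
      ⟨-(a + √2 * Real.pi / 2), by ring⟩
    have h1 := h u
    have h2 := h (u + √2 * Real.pi)
    rw [show √2 * (u + √2 * Real.pi + T) + b = √2 * (u + T) + b + 2 * Real.pi by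
        linear_combination Real.pi * hs,
      show √2 * (u + √2 * Real.pi) + b = √2 * u + b + 2 * Real.pi by
        linear_combination Real.pi * hs,
      Real.sin_add_two_pi, Real.sin_add_two_pi,
      show u + √2 * Real.pi + T + a = u + T + a + 2 * (√2 * Real.pi / 2) by ring,
      show u + √2 * Real.pi + a = u + a + 2 * (√2 * Real.pi / 2) by ring] at h2
    have h3 := sub_eq (u + T + a) (√2 * Real.pi / 2)
    have h4 := sub_eq (u + a) (√2 * Real.pi / 2)
    rw [hu, Real.cos_zero] at h4
    rw [show u + T + a + √2 * Real.pi / 2 = T by linear_combination hu] at h3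
    have h5 : 2 * Real.sin (√2 * Real.pi / 2) * Real.cos T =
      2 * Real.sin (√2 * Real.pi / 2) * 1 := by linarith
    exact mul_left_cancel₀ (by positivity) h5
  by_contra hT
  have hm0 : m ≠ 0 := by
    rintro rfl
    simp [← hm] at hT
  refine (irrational_sqrt_two.mul_intCast hm0).ne_int n ?_
  refine mul_right_cancel₀ Real.two_pi_pos.ne' ?_
  rw [hn, mul_assoc, hm]

/-- `modSq a b` is not homogeneous under any nontrivial dilation. -/
lemma not_forall_modSq_mul_eq (a b : ℝ) {μ : ℝ} (hμ : 1 < μ) :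
    ¬ ∀ t, 0 < t → modSq a b (μ * t) = μ ^ 2 * modSq a b t := by
  intro h
  have hμ0 : 0 < μ := by linarith
  refine (Real.log_pos hμ).ne' (eq_zero_of_periodic_sin_add_sin (a := a) (b := b) fun u => ?_)
  have h1 := h (Real.exp u) (Real.exp_pos u)
  rw [modSq_mul a b hμ0 (Real.exp_pos u)] at h1
  have h2 := mul_left_cancel₀ (by positivity) h1
  unfold modSq at h2
  have h3 := mul_left_cancel₀ (by positivity) h2
  rw [Real.log_exp] at h3
  rw [show u + Real.log μ + a = u + (a + Real.log μ) by ring,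
    show √2 * (u + Real.log μ) + b = √2 * u + (b + √2 * Real.log μ) by ring]
  linarith

lemma modNorm_vertical (z : ℝ) : modNorm (0, 0, z) = modSqrt z := by
  simp [modNorm, modSqrt_nonneg]

lemma modSqrt_dil_le_iff {l z r : ℝ} (hl : 0 < l) (hz : 0 ≤ z) (hr : 0 < r) :
    1 / l * modSqrt (l ^ 2 * z) ≤ r ↔ z ≤ modSq (Real.log l) (√2 * Real.log l) r := by
  rw [one_div, inv_mul_le_iff₀ hl, modSqrt_le_iff _ (by positivity), modSq_mul 0 0 hl hr,
    abs_of_nonneg (by positivity), zero_add, zero_add, mul_le_mul_iff_right₀ (by positivity)]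

/-- If the rescalings of `modSq 0 0` converge, those of `modSqrt` converge to the inverse. -/
lemma tendsto_modSqrt {l : ℕ → ℝ} (hl : ∀ j, 0 < l j) {α β : ℝ}
    (h : ∀ r, Filter.Tendsto (fun j => modSq (Real.log (l j)) (√2 * Real.log (l j)) r)
      Filter.atTop (nhds (modSq α β r))) {t : ℝ} (ht : 0 < t) :
    Filter.Tendsto (fun j => 1 / l j * modSqrt (l j ^ 2 * modSq α β t))
      Filter.atTop (nhds t) := by
  have hmono := strictMonoOn_modSq α β
  have hz : 0 ≤ modSq α β t := le_trans (by positivity) (four_mul_sq_le_modSq α β t)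
  refine tendsto_order.2 ⟨fun r hr => ?_, fun r hr => ?_⟩
  · obtain ⟨s, hs, hst⟩ := exists_between (max_lt hr ht)
    have hs0 : 0 < s := (le_max_right _ _).trans_lt hs
    filter_upwards [(h s).eventually_lt_const (hmono hs0.le ht.le hst)] with j hj
    refine ((le_max_left _ _).trans_lt hs).trans ?_
    exact not_le.1 fun hle => hj.not_ge ((modSqrt_dil_le_iff (hl j) hz hs0).1 hle)
  · obtain ⟨s, hts, hsr⟩ := exists_between hr
    have hs0 : 0 < s := ht.trans hts
    filter_upwards [(h s).eventually_const_lt (hmono ht.le hs0.le hts)] with j hj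
    exact ((modSqrt_dil_le_iff (hl j) hz hs0).2 hj.le).trans_lt hsr

/-- Theorem 1.5 (1). There exists a left-invariant distance `d₁` on `ℍ`,
biLipschitz equivalent to `d_b`, no blow-up of which is self-similar. -/
theorem statement4 :
    ∃ d₁ : H → H → ℝ, IsDistance d₁ ∧
      (∃ C : ℝ, 1 ≤ C ∧ ∀ p q : H, C⁻¹ * dbox p q ≤ d₁ p q ∧ d₁ p q ≤ C * dbox p q) ∧
      (∀ g p q : H, d₁ (Hmul g p) (Hmul g q) = d₁ p q) ∧
      ∀ (lam : ℕ → ℝ) (qs : ℕ → H) (ρ : H → H → ℝ),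
        (∀ j, 0 < lam j) →
        Filter.Tendsto lam Filter.atTop (nhds 0) →
        (∀ p₁ p₂ : H, Filter.Tendsto
          (fun j => (1 / lam j) *
            d₁ (Hmul (qs j) (dil (lam j) p₁)) (Hmul (qs j) (dil (lam j) p₂)))
          Filter.atTop (nhds (ρ p₁ p₂))) →
        ¬ ∃ lam' : ℝ, 1 < lam' ∧
            ∀ p q : H, ρ (dil lam' p) (dil lam' q) = lam' * ρ p q := by
  refine ⟨modDist, isDistance_modDist, ⟨3, by norm_num, fun p q => ⟨?_, ?_⟩⟩,
    modDist_Hmul_left, ?_⟩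
  · rw [inv_mul_le_iff₀ (by norm_num)]
    exact boxNorm_le_three_mul_modNorm _
  · exact (modNorm_le_boxNorm _).trans (le_mul_of_one_le_left (boxNorm_nonneg _) (by norm_num))
  rintro lam qs ρ hlam - hρ ⟨μ, hμ, hself⟩
  have hμ0 : 0 < μ := by linarith
  obtain ⟨α, β, φ, hφ, hlim⟩ := exists_subseq_tendsto_modSq
    (fun j => Real.log (lam j)) (fun j => √2 * Real.log (lam j))
  have hR (t : ℝ) (ht : 0 < t) : ρ (0, 0, 0) (0, 0, modSq α β t) = t := by
    refine tendsto_nhds_unique ((hρ _ _).comp hφ.tendsto_atTop) ?_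
    refine (tendsto_modSqrt (l := fun j => lam (φ j)) (fun j => hlam _) hlim ht).congr fun j => ?_
    simp only [Function.comp_apply, modDist_Hmul_left]
    simp [modDist, dil, Hmul, Hinv, modNorm_vertical]
  refine not_forall_modSq_mul_eq α β hμ fun t ht => ?_
  have hz : 0 < modSq α β t := lt_of_lt_of_le (by positivity) (four_mul_sq_le_modSq α β t)
  obtain ⟨s, hs, hst⟩ := exists_modSq_eq α β (z := μ ^ 2 * modSq α β t) (by positivity)
  have hs0 : 0 < s := by
    refine hs.lt_of_ne ?_
    rintro rfl
    rw [modSq_zero] at hst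
    exact (by positivity : 0 < μ ^ 2 * modSq α β t).ne hst
  have h := hself (0, 0, 0) (0, 0, modSq α β t)
  simp only [dil, mul_zero] at h
  rw [← hst, hR s hs0, hR t ht] at h
  rw [← h, hst]

end Heis
end

section
/- Consider the 16 similitudes of the Heisenberg group S_{i,j,k}(p) = (i/2, j/2, k/4)·δ_{1/2}(p), for i, j ∈ {0,1}, k ∈ {0,1,2,3}, and let K ⊆ ℍ be a nonempty compact set with K = ⋃_{i,j,k} S_{i,j,k}(K). Then K has nonempty interior (in the topology of ℝ³), and the metric space (K, d_b) is Ahlfors 4-regular. -/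
open scoped ENNReal

namespace Heis

/-- The 16 similitudes `S_{i,j,k}(p) = (i/2, j/2, k/4) · δ_{1/2}(p)` of the Heisenberg
group, indexed by `(i, j, k) ∈ {0,1} × {0,1} × {0,1,2,3}`. -/
noncomputable def Sim (a : Fin 2 × Fin 2 × Fin 4) (p : H) : H :=
  Hmul (((a.1 : ℕ) : ℝ) / 2, ((a.2.1 : ℕ) : ℝ) / 2, ((a.2.2 : ℕ) : ℝ) / 4) (dil (1 / 2) p)

/-- For a word `𝐢 = (i₁, …, i_m)`, the composition `S_𝐢 = S_{i₁} ∘ ⋯ ∘ S_{i_m}`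
(with `S_∅ = id`). -/
noncomputable def SWord : List (Fin 2 × Fin 2 × Fin 4) → H → H
  | [] => id
  | a :: w => Sim a ∘ SWord w


open MeasureTheory Set

theorem boxNorm_le_iff_s17 (u : H) {s : ℝ} (hs : 0 ≤ s) :
    boxNorm u ≤ s ↔ |u.1| ≤ s ∧ |u.2.1| ≤ s ∧ |u.2.2| ≤ s ^ 2 := by
  unfold boxNorm
  rw [max_le_iff, max_le_iff, Real.sqrt_le_left hs]

theorem boxNorm_dil {s : ℝ} (hs : 0 ≤ s) (u : H) : boxNorm (dil s u) = s * boxNorm u := by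
  simp only [boxNorm, dil, abs_mul, abs_of_nonneg hs, abs_of_nonneg (sq_nonneg s)]
  rw [Real.sqrt_mul (sq_nonneg s), Real.sqrt_sq hs, mul_max_of_nonneg _ _ hs,
    mul_max_of_nonneg _ _ hs]

theorem Hmul_Hinv_Hmul (g p q : H) :
    Hmul (Hinv (Hmul g p)) (Hmul g q) = Hmul (Hinv p) q := by
  ext <;> simp only [Hmul, Hinv] <;> ring

theorem Hmul_Hmul_Hinv_cancel (p q : H) : Hmul p (Hmul (Hinv p) q) = q := by
  ext <;> simp only [Hmul, Hinv] <;> ring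

theorem Hmul_Hinv_Hmul_cancel (p q : H) : Hmul (Hinv p) (Hmul p q) = q := by
  ext <;> simp only [Hmul, Hinv] <;> ring

theorem dbox_Hmul (g p q : H) : dbox (Hmul g p) (Hmul g q) = dbox p q := by
  simp only [dbox, Hmul_Hinv_Hmul]

theorem dbox_dil {s : ℝ} (hs : 0 ≤ s) (p q : H) : dbox (dil s p) (dil s q) = s * dbox p q := by
  rw [dbox, dbox, ← boxNorm_dil hs]
  congr 1
  ext <;> simp only [Hmul, Hinv, dil] <;> ring

theorem dbox_Sim (a : Fin 2 × Fin 2 × Fin 4) (p q : H) :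
    dbox (Sim a p) (Sim a q) = 1 / 2 * dbox p q := by
  rw [Sim, Sim, dbox_Hmul, dbox_dil (by norm_num)]

theorem continuous_Hmul (g : H) : Continuous (Hmul g) := by
  unfold Hmul
  fun_prop

theorem continuous_dbox : Continuous fun p : H × H => dbox p.1 p.2 := by
  unfold dbox boxNorm Hmul Hinv
  fun_prop

theorem measurePreserving_Hmul (g : H) : MeasurePreserving (Hmul g) := by
  have h1 : MeasurePreserving (fun x : ℝ => g.1 + x) := measurePreserving_add_left volume g.1
  have h3 : ∀ x : ℝ, MeasurePreserving
      (fun p : ℝ × ℝ => (g.2.1 + p.1, g.2.2 + p.2 + (g.1 * p.1 - g.2.1 * x) / 2)) := by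
    intro x
    refine (measurePreserving_add_left volume g.2.1).skew_product
      (g := fun y z => g.2.2 + z + (g.1 * y - g.2.1 * x) / 2) ?_ ?_
    · unfold Function.uncurry
      fun_prop
    · refine Filter.Eventually.of_forall fun y => ?_
      have h := (measurePreserving_add_left (volume : Measure ℝ)
        (g.2.2 + (g.1 * y - g.2.1 * x) / 2)).map_eq
      rw [← h]
      congr 1
      funext z
      ring
  exact h1.skew_product
    (g := fun x (p : ℝ × ℝ) => (g.2.1 + p.1, g.2.2 + p.2 + (g.1 * p.1 - g.2.1 * x) / 2))
    (by unfold Function.uncurry; fun_prop) (Filter.Eventually.of_forall fun x => (h3 x).map_eq)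

/-- Left translation as a homeomorphism. -/
noncomputable def leftTranslation (g : H) : H ≃ₜ H where
  toFun := Hmul g
  invFun := Hmul (Hinv g)
  left_inv := Hmul_Hinv_Hmul_cancel g
  right_inv := Hmul_Hmul_Hinv_cancel g
  continuous_toFun := continuous_Hmul g
  continuous_invFun := continuous_Hmul _

theorem volume_Hmul_image (g : H) (A : Set H) : volume (Hmul g '' A) = volume A := by
  have h := (measurePreserving_Hmul g).measure_preimage_emb
    (leftTranslation g).measurableEmbedding (Hmul g '' A)
  exact h.symm.trans (congrArg volume (preimage_image_eq A (leftTranslation g).injective))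

theorem volume_dil_image (s : ℝ) (A : Set H) :
    volume (dil s '' A) = ENNReal.ofReal (s ^ 4) * volume A := by
  let f : H →ₗ[ℝ] H := LinearMap.prodMap (s • LinearMap.id)
    (LinearMap.prodMap (s • LinearMap.id) (s ^ 2 • LinearMap.id))
  have hf : dil s = f := by
    funext p
    simp [f, dil]
  have hdet : LinearMap.det f = s ^ 4 := by
    simp only [f, LinearMap.det_prodMap, LinearMap.det_smul, LinearMap.det_id, Module.finrank_self]
    ring
  have h2 : (volume : Measure (ℝ × ℝ)).IsAddHaarMeasure :=
    Measure.prod.instIsAddHaarMeasure volume volume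
  have h3 : (volume : Measure H).IsAddHaarMeasure :=
    Measure.prod.instIsAddHaarMeasure volume volume
  rw [hf, Measure.addHaar_image_linearMap, hdet, abs_of_nonneg (by positivity)]

theorem volume_Sim_image (a : Fin 2 × Fin 2 × Fin 4) (A : Set H) :
    volume (Sim a '' A) = ENNReal.ofReal (1 / 16) * volume A := by
  have h : Sim a '' A = Hmul (((a.1 : ℕ) : ℝ) / 2, ((a.2.1 : ℕ) : ℝ) / 2, ((a.2.2 : ℕ) : ℝ) / 4) ''
      (dil (1 / 2) '' A) := by
    rw [image_image]
    rfl
  rw [h, volume_Hmul_image, volume_dil_image]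
  norm_num

/-- Each integer point is `δ₂(γ) · a` for an integer point `γ` and a digit `a`. -/
theorem dil_Hmul_int_eq_Hmul_Sim (m n l : ℤ) : ∃ (m' n' l' : ℤ) (a : Fin 2 × Fin 2 × Fin 4),
    ∀ k : H, dil (1 / 2) (Hmul ((m : ℝ), (n : ℝ), (l : ℝ)) k) =
      Hmul ((m' : ℝ), (n' : ℝ), (l' : ℝ)) (Sim a k) := by
  obtain ⟨m', i, hi, hm⟩ : ∃ (m' : ℤ) (i : ℕ), i < 2 ∧ m = 2 * m' + i :=
    ⟨m / 2, (m % 2).toNat, by omega, by omega⟩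
  obtain ⟨n', j, hj, hn⟩ : ∃ (n' : ℤ) (j : ℕ), j < 2 ∧ n = 2 * n' + j :=
    ⟨n / 2, (n % 2).toNat, by omega, by omega⟩
  obtain ⟨l', k, hk, hl⟩ : ∃ (l' : ℤ) (k : ℕ), k < 4 ∧ l - (m' * j - n' * i) = 4 * l' + k :=
    ⟨(l - (m' * j - n' * i)) / 4, ((l - (m' * j - n' * i)) % 4).toNat, by omega, by omega⟩
  have hl' : l = 4 * l' + k + (m' * j - n' * i) := by linarith
  refine ⟨m', n', l', (⟨i, hi⟩, ⟨j, hj⟩, ⟨k, hk⟩), fun p => ?_⟩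
  rw [hm, hn, hl']
  ext <;> simp only [Sim, Hmul, dil] <;> push_cast <;> ring

theorem exists_int_Hmul_near (k q : H) : ∃ m n l : ℤ,
    |(Hmul ((m : ℝ), (n : ℝ), (l : ℝ)) k).1 - q.1| ≤ 1 ∧
    |(Hmul ((m : ℝ), (n : ℝ), (l : ℝ)) k).2.1 - q.2.1| ≤ 1 ∧
    |(Hmul ((m : ℝ), (n : ℝ), (l : ℝ)) k).2.2 - q.2.2| ≤ 1 := by
  have hfl : ∀ x : ℝ, ∃ m : ℤ, (m : ℝ) ≤ x ∧ x < m + 1 :=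
    fun x => ⟨⌊x⌋, Int.floor_le x, Int.lt_floor_add_one x⟩
  obtain ⟨m, hm⟩ := hfl (q.1 - k.1)
  obtain ⟨n, hn⟩ := hfl (q.2.1 - k.2.1)
  obtain ⟨l, hl⟩ := hfl (q.2.2 - k.2.2 - (m * k.2.1 - n * k.1) / 2)
  refine ⟨m, n, l, ?_⟩
  simp only [Hmul, abs_le]
  refine ⟨⟨?_, ?_⟩, ⟨?_, ?_⟩, ?_, ?_⟩ <;> linarith [hm.1, hm.2, hn.1, hn.2, hl.1, hl.2]

/-- The union of the integer translates of `K`. -/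
def integerTranslates (K : Set H) : Set H :=
  ⋃ g : ℤ × ℤ × ℤ, Hmul ((g.1 : ℝ), (g.2.1 : ℝ), (g.2.2 : ℝ)) '' K

theorem dil_half_mem_integerTranslates {K : Set H} (hS : ∀ a, ∀ k ∈ K, Sim a k ∈ K) {p : H}
    (hp : p ∈ integerTranslates K) : dil (1 / 2) p ∈ integerTranslates K := by
  obtain ⟨g, k, hk, rfl⟩ := mem_iUnion.1 hp
  obtain ⟨m, n, l, a, h⟩ := dil_Hmul_int_eq_Hmul_Sim g.1 g.2.1 g.2.2
  exact mem_iUnion.2 ⟨(m, n, l), Sim a k, hS a k hk, (h k).symm⟩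

theorem exists_mem_integerTranslates_near {K : Set H} (hne : K.Nonempty)
    (hS : ∀ a, ∀ k ∈ K, Sim a k ∈ K) (N : ℕ) (q : H) :
    ∃ t ∈ integerTranslates K, |t.1 - q.1| ≤ (1 / 2) ^ N ∧ |t.2.1 - q.2.1| ≤ (1 / 2) ^ N ∧
      |t.2.2 - q.2.2| ≤ (1 / 2) ^ N := by
  induction N generalizing q with
  | zero =>
    obtain ⟨k, hk⟩ := hne
    obtain ⟨m, n, l, h⟩ := exists_int_Hmul_near k q
    exact ⟨_, mem_iUnion.2 ⟨(m, n, l), k, hk, rfl⟩, by simpa using h⟩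
  | succ N ih =>
    obtain ⟨t, ht, h1, h2, h3⟩ := ih (dil 2 q)
    refine ⟨_, dil_half_mem_integerTranslates hS ht, ?_⟩
    simp only [dil, abs_le, pow_succ] at h1 h2 h3 ⊢
    have : (0 : ℝ) < (1 / 2) ^ N := by positivity
    refine ⟨⟨?_, ?_⟩, ⟨?_, ?_⟩, ?_, ?_⟩ <;> linarith [h1.1, h1.2, h2.1, h2.2, h3.1, h3.2]

theorem isCompact_Hmul_image {K : Set H} (hK : IsCompact K) (g : H) : IsCompact (Hmul g '' K) :=
  hK.image (continuous_Hmul g)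

theorem finite_int_Hmul_near {K : Set H} (hK : IsCompact K) (q : H) :
    {g : ℤ × ℤ × ℤ | ∃ t ∈ Hmul ((g.1 : ℝ), (g.2.1 : ℝ), (g.2.2 : ℝ)) '' K,
      dist t q ≤ 1}.Finite := by
  obtain ⟨M, hM⟩ := hK.isBounded.exists_norm_le
  let B := ‖q‖ + 1 + M
  refine ((finite_Icc (-⌈B⌉) ⌈B⌉).prod ((finite_Icc (-⌈B⌉) ⌈B⌉).prod
    (finite_Icc (-⌈B + B * M⌉) ⌈B + B * M⌉))).subset ?_
  rintro ⟨m, n, l⟩ ⟨_, ⟨k, hk, rfl⟩, ht⟩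
  have hkM := hM k hk
  have hM0 : 0 ≤ M := (norm_nonneg k).trans hkM
  have htq : ‖Hmul ((m : ℝ), (n : ℝ), (l : ℝ)) k‖ ≤ ‖q‖ + 1 := by
    have := norm_le_norm_add_norm_sub q (Hmul ((m : ℝ), (n : ℝ), (l : ℝ)) k)
    rw [dist_eq_norm, norm_sub_rev] at ht
    linarith
  simp only [Prod.norm_def, max_le_iff, Real.norm_eq_abs, Hmul] at hkM htq
  obtain ⟨k1, k2, k3⟩ := hkM
  obtain ⟨t1, t2, t3⟩ := htq
  have hm : |(m : ℝ)| ≤ B := by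
    rw [abs_le] at *
    constructor <;> simp only [B, Prod.norm_def, Real.norm_eq_abs] <;> linarith
  have hn : |(n : ℝ)| ≤ B := by
    rw [abs_le] at *
    constructor <;> simp only [B, Prod.norm_def, Real.norm_eq_abs] <;> linarith
  have hB0 : 0 ≤ B := (abs_nonneg _).trans hm
  have h1 : |(m : ℝ) * k.2.1| ≤ B * M := by
    rw [abs_mul]
    gcongr
  have h2 : |(n : ℝ) * k.1| ≤ B * M := by
    rw [abs_mul]
    gcongr
  have hl : |(l : ℝ)| ≤ B + B * M := by
    rw [abs_le] at *
    constructor <;> simp only [B, Prod.norm_def, Real.norm_eq_abs] at * <;> linarith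
  have key : ∀ (i : ℤ) (b : ℝ), |(i : ℝ)| ≤ b → i ∈ Icc (-⌈b⌉) ⌈b⌉ := by
    intro i b hb
    rw [abs_le] at hb
    have hc := Int.le_ceil b
    constructor
    · have : (-⌈b⌉ : ℝ) ≤ i := by linarith
      exact_mod_cast this
    · have : (i : ℝ) ≤ ⌈b⌉ := by linarith
      exact_mod_cast this
  exact ⟨key m B hm, key n B hn, key l _ hl⟩

theorem integerTranslates_eq_univ {K : Set H} (hne : K.Nonempty) (hK : IsCompact K)
    (hS : ∀ a, ∀ k ∈ K, Sim a k ∈ K) : integerTranslates K = univ := by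
  refine eq_univ_of_forall fun q => ?_
  let F := {g : ℤ × ℤ × ℤ | ∃ t ∈ Hmul ((g.1 : ℝ), (g.2.1 : ℝ), (g.2.2 : ℝ)) '' K, dist t q ≤ 1}
  have hclosed : IsClosed (⋃ g ∈ F, Hmul ((g.1 : ℝ), (g.2.1 : ℝ), (g.2.2 : ℝ)) '' K) :=
    (finite_int_Hmul_near hK q).isClosed_biUnion fun g _ => (isCompact_Hmul_image hK _).isClosed
  have hq : q ∈ ⋃ g ∈ F, Hmul ((g.1 : ℝ), (g.2.1 : ℝ), (g.2.2 : ℝ)) '' K := by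
    rw [← hclosed.closure_eq, Metric.mem_closure_iff]
    intro ε hε
    obtain ⟨N, hN⟩ := exists_pow_lt_of_lt_one hε (by norm_num : (1 / 2 : ℝ) < 1)
    obtain ⟨t, ht, h1, h2, h3⟩ := exists_mem_integerTranslates_near hne hS N q
    have hd : dist t q ≤ (1 / 2) ^ N := by
      simp only [Prod.dist_eq, Real.dist_eq]
      exact max_le h1 (max_le h2 h3)
    obtain ⟨g, hg⟩ := mem_iUnion.1 ht
    refine ⟨t, mem_iUnion₂.2 ⟨g, ⟨t, hg, hd.trans (pow_le_one₀ (by norm_num) (by norm_num))⟩, hg⟩,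
      ?_⟩
    rw [dist_comm]
    exact hd.trans_lt hN
  obtain ⟨g, -, hg⟩ := mem_iUnion₂.1 hq
  exact mem_iUnion.2 ⟨g, hg⟩

theorem interior_nonempty_of_forall_Sim_mem {K : Set H} (hne : K.Nonempty) (hK : IsCompact K)
    (hS : ∀ a, ∀ k ∈ K, Sim a k ∈ K) : (interior K).Nonempty := by
  obtain ⟨g, hg⟩ := nonempty_interior_of_iUnion_of_closed
    (fun g : ℤ × ℤ × ℤ => (isCompact_Hmul_image hK ((g.1 : ℝ), (g.2.1 : ℝ), (g.2.2 : ℝ))).isClosed)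
    (integerTranslates_eq_univ hne hK hS)
  have h := (leftTranslation ((g.1 : ℝ), (g.2.1 : ℝ), (g.2.2 : ℝ))).image_interior K
  rw [← image_nonempty, h]
  exact hg

theorem exists_dbox_le {K : Set H} (hK : IsCompact K) :
    ∃ D : ℝ, 0 < D ∧ ∀ p ∈ K, ∀ q ∈ K, dbox p q ≤ D := by
  obtain ⟨D, hD⟩ := (hK.prod hK).exists_bound_of_continuousOn continuous_dbox.continuousOn
  refine ⟨max D 1, by positivity, fun p hp q hq => ?_⟩
  exact (le_abs_self _).trans ((hD (p, q) ⟨hp, hq⟩).trans (le_max_left _ _))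

/-- Around each point of `K` there is a piece of generation `n`. -/
theorem exists_piece {K : Set H} (hself : K = ⋃ a : Fin 2 × Fin 2 × Fin 4, Sim a '' K) {D : ℝ}
    (hD : ∀ p ∈ K, ∀ q ∈ K, dbox p q ≤ D) (n : ℕ) {x : H} (hx : x ∈ K) :
    ∃ A ⊆ K, x ∈ A ∧ volume A = ENNReal.ofReal ((1 / 16) ^ n) * volume K ∧
      ∀ p ∈ A, ∀ q ∈ A, dbox p q ≤ (1 / 2) ^ n * D := by
  induction n generalizing x with
  | zero => exact ⟨K, Subset.rfl, hx, by simp, by simpa using hD⟩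
  | succ n ih =>
    obtain ⟨a, x', hx', rfl⟩ : ∃ a, x ∈ Sim a '' K := mem_iUnion.1 (hself ▸ hx)
    obtain ⟨A, hA, hxA, hvol, hdiam⟩ := ih hx'
    refine ⟨Sim a '' A, ?_, mem_image_of_mem _ hxA, ?_, ?_⟩
    · rw [hself]
      exact (image_mono hA).trans (subset_iUnion (fun a => Sim a '' K) a)
    · rw [volume_Sim_image, hvol, ← mul_assoc, ← ENNReal.ofReal_mul (by norm_num), pow_succ']
    · rintro _ ⟨p, hp, rfl⟩ _ ⟨q, hq, rfl⟩
      rw [dbox_Sim, pow_succ']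
      have := hdiam p hp q hq
      linarith

theorem volume_le_of_dbox_le {E : Set H} {y : H} {s : ℝ} (hs : 0 ≤ s)
    (h : ∀ q ∈ E, dbox y q ≤ s) : volume E ≤ ENNReal.ofReal (8 * s ^ 4) := by
  have hsub : E ⊆ Hmul y '' (Icc (-s) s ×ˢ (Icc (-s) s ×ˢ Icc (-s ^ 2) (s ^ 2))) := by
    intro q hq
    obtain ⟨h1, h2, h3⟩ := (boxNorm_le_iff_s17 _ hs).1 (h q hq)
    exact ⟨Hmul (Hinv y) q, ⟨abs_le.1 h1, abs_le.1 h2, abs_le.1 h3⟩, Hmul_Hmul_Hinv_cancel y q⟩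
  refine (measure_mono hsub).trans ?_
  rw [volume_Hmul_image, Measure.volume_eq_prod, Measure.prod_prod, Measure.volume_eq_prod,
    Measure.prod_prod, Real.volume_Icc, Real.volume_Icc, ← ENNReal.ofReal_mul (by linarith),
    ← ENNReal.ofReal_mul (by linarith)]
  exact ENNReal.ofReal_le_ofReal (by nlinarith)

theorem volume_le_ediamOf {K : Set H} (E : Set K) :
    volume (Subtype.val '' E) ≤
      8 * ediamOf (fun x y : K => dbox (x : H) (y : H)) E ^ (4 : ℝ) := by
  set d := ediamOf (fun x y : K => dbox (x : H) (y : H)) E with hd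
  obtain rfl | ⟨y, hy⟩ := E.eq_empty_or_nonempty
  · simp
  obtain htop | htop := eq_or_ne d ⊤
  · simp [htop]
  have h : ∀ q ∈ Subtype.val '' E, dbox (y : H) q ≤ d.toReal := by
    rintro _ ⟨q, hq, rfl⟩
    rw [← ENNReal.ofReal_le_iff_le_toReal htop]
    exact le_iSup₂_of_le y hy
      (le_iSup₂ (f := fun (q : K) (_ : q ∈ E) => ENNReal.ofReal (dbox (y : H) q)) q hq)
  refine (volume_le_of_dbox_le ENNReal.toReal_nonneg h).trans_eq ?_
  rw [ENNReal.ofReal_mul (by norm_num), ENNReal.ofReal_pow ENNReal.toReal_nonneg,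
    ENNReal.ofReal_toReal htop, ENNReal.rpow_ofNat]
  norm_num

theorem volume_le_hausdorffOf {K : Set H} (B : Set K) :
    volume (Subtype.val '' B) ≤
      8 * hausdorffOf (fun x y : K => dbox (x : H) (y : H)) 4 B := by
  suffices h : volume (Subtype.val '' B) / 8 ≤
      hausdorffOf (fun x y : K => dbox (x : H) (y : H)) 4 B by
    rwa [ENNReal.div_le_iff' (by norm_num) (by norm_num)] at h
  refine le_iSup₂_of_le ⊤ ENNReal.zero_lt_top
    (le_iInf fun E => le_iInf fun hE => le_iInf fun _ => ?_)
  rw [ENNReal.div_le_iff' (by norm_num) (by norm_num), ← ENNReal.tsum_mul_left]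
  calc volume (Subtype.val '' B) ≤ volume (⋃ n, Subtype.val '' E n) := by
        rw [← image_iUnion]
        exact measure_mono (image_mono hE)
    _ ≤ ∑' n, volume (Subtype.val '' E n) := measure_iUnion_le _
    _ ≤ _ := ENNReal.tsum_le_tsum fun n => volume_le_ediamOf (E n)

theorem hausdorffOf_le_of_finite_covers {X : Type*} {d : X → X → ℝ} {Q : ℝ} (hQ : 0 < Q)
    {A : Set X} {c : ℝ≥0∞}
    (h : ∀ ε : ℝ≥0∞, 0 < ε → ∃ (ι : Type) (s : Finset ι) (E : ι → Set X) (δ : ℝ≥0∞),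
      A ⊆ ⋃ i ∈ s, E i ∧ (∀ i, ediamOf d (E i) ≤ δ) ∧ δ ≤ ε ∧ s.card * δ ^ Q ≤ c) :
    hausdorffOf d Q A ≤ c := by
  refine iSup₂_le fun ε hε => ?_
  obtain ⟨ι, s, E, δ, hcov, hdiam, hδ, hsum⟩ := h ε hε
  let F : ℕ → Set X := fun n => if hn : n < s.card then E (s.equivFin.symm ⟨n, hn⟩) else ∅
  have hempty : ediamOf d ∅ = 0 := by simp [ediamOf]
  have hF : ∀ n, ediamOf d (F n) ≤ δ := by
    intro n
    by_cases hn : n < s.card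
    · simpa only [F, dif_pos hn] using hdiam _
    · simp only [F, dif_neg hn, hempty, zero_le]
  refine iInf_le_of_le F (iInf_le_of_le ?_ (iInf_le_of_le (fun n => (hF n).trans hδ) ?_))
  · intro x hx
    obtain ⟨i, hi, hxi⟩ := mem_iUnion₂.1 (hcov hx)
    refine mem_iUnion.2 ⟨s.equivFin ⟨i, hi⟩, ?_⟩
    simpa [F] using hxi
  · rw [tsum_eq_sum (s := Finset.range s.card)]
    · refine le_trans (Finset.sum_le_card_nsmul _ _ (δ ^ Q) fun n _ => ?_) ?_
      · exact ENNReal.rpow_le_rpow (hF n) hQ.le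
      · simpa using hsum
    · intro n hn
      have hn' : ¬ n < s.card := by simpa using hn
      simp only [F, dif_neg hn', hempty, ENNReal.zero_rpow_of_pos hQ]

/-- The cell of size `s` with integer index `g` in the grid on `ℍ` based at `x`. -/
def cell (x : H) (s : ℝ) (g : ℤ × ℤ × ℤ) : Set H :=
  {q | let u := Hmul (Hinv x) q
    ⌊u.1 / s⌋ = g.1 ∧ ⌊u.2.1 / s⌋ = g.2.1 ∧
    ⌊(u.2.2 + (g.2.1 * s * u.1 - g.1 * s * u.2.1) / 2) / s ^ 2⌋ = g.2.2}

theorem dbox_le_of_mem_cell {x : H} {s : ℝ} (hs : 0 < s) {g : ℤ × ℤ × ℤ} {p q : H}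
    (hp : p ∈ cell x s g) (hq : q ∈ cell x s g) : dbox p q ≤ 2 * s := by
  obtain ⟨hp1, hp2, hp3⟩ := hp
  obtain ⟨hq1, hq2, hq3⟩ := hq
  have e : dbox p q = boxNorm (Hmul (Hinv (Hmul (Hinv x) p)) (Hmul (Hinv x) q)) := by
    rw [Hmul_Hinv_Hmul, dbox]
  rw [e, boxNorm_le_iff_s17 _ (by positivity)]
  set u := Hmul (Hinv x) p
  set v := Hmul (Hinv x) q
  obtain ⟨m, n, l⟩ := g
  have hs2 : 0 < s ^ 2 := by positivity
  rw [Int.floor_eq_iff, le_div_iff₀ (by assumption), div_lt_iff₀ (by assumption)]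
    at hp1 hp2 hp3 hq1 hq2 hq3
  simp only at hp1 hp2 hp3 hq1 hq2 hq3
  have h1 : 0 ≤ u.1 - m * s ∧ u.1 - m * s ≤ s := by constructor <;> linarith
  have h2 : 0 ≤ u.2.1 - n * s ∧ u.2.1 - n * s ≤ s := by constructor <;> linarith
  have h3 : 0 ≤ v.1 - m * s ∧ v.1 - m * s ≤ s := by constructor <;> linarith
  have h4 : 0 ≤ v.2.1 - n * s ∧ v.2.1 - n * s ≤ s := by constructor <;> linarith
  have a1 := mul_nonneg h2.1 h3.1
  have a2 := mul_nonneg h1.1 h4.1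
  have a3 : (u.2.1 - n * s) * (v.1 - m * s) ≤ s * s := mul_le_mul h2.2 h3.2 h3.1 hs.le
  have a4 : (u.1 - m * s) * (v.2.1 - n * s) ≤ s * s := mul_le_mul h1.2 h4.2 h4.1 hs.le
  simp only [Hmul, Hinv, abs_le]
  refine ⟨⟨by linarith, by linarith⟩, ⟨by linarith, by linarith⟩, by nlinarith, by nlinarith⟩

theorem exists_mem_cell {x q : H} {r : ℝ} (hr : 0 < r) (h : dbox x q < r) {N : ℕ} (hN : 0 < N) :
    ∃ g ∈ Finset.Ico (-N : ℤ) N ×ˢ (Finset.Ico (-N : ℤ) N ×ˢ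
        Finset.Ico (-(2 * N ^ 2) : ℤ) (2 * N ^ 2 + 1)),
      q ∈ cell x (r / N) g := by
  have hN' : (0 : ℝ) < N := by exact_mod_cast hN
  set s := r / N with hs
  have hs0 : 0 < s := by positivity
  have hrs : r = N * s := by rw [hs]; field_simp
  set u := Hmul (Hinv x) q with hu
  have hlt : |u.1| < r ∧ |u.2.1| < r := by
    simp only [dbox, boxNorm, max_lt_iff] at h
    exact ⟨h.1, h.2.1⟩
  obtain ⟨-, -, h3⟩ := (boxNorm_le_iff_s17 _ hr.le).1 h.le
  rw [← hu] at h3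
  have hI : ∀ t : ℝ, |t| < r → ⌊t / s⌋ ∈ Finset.Ico (-N : ℤ) N ∧ |⌊t / s⌋ * s| ≤ r := by
    intro t ht
    rw [abs_lt] at ht
    have hmem : ⌊t / s⌋ ∈ Finset.Ico (-N : ℤ) N := by
      rw [Finset.mem_Ico, Int.le_floor, Int.floor_lt, le_div_iff₀ hs0, div_lt_iff₀ hs0]
      push_cast
      constructor <;> linarith
    refine ⟨hmem, ?_⟩
    rw [abs_mul, abs_of_pos hs0, hrs]
    gcongr
    rw [Finset.mem_Ico] at hmem
    rw [abs_le]
    constructor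
    · exact_mod_cast hmem.1
    · exact_mod_cast hmem.2.le
  obtain ⟨m1, m2⟩ := hI _ hlt.1
  obtain ⟨n1, n2⟩ := hI _ hlt.2
  refine ⟨(⌊u.1 / s⌋, ⌊u.2.1 / s⌋,
    ⌊(u.2.2 + (⌊u.2.1 / s⌋ * s * u.1 - ⌊u.1 / s⌋ * s * u.2.1) / 2) / s ^ 2⌋), ?_, rfl, rfl, rfl⟩
  simp only [Finset.mem_product]
  refine ⟨m1, n1, ?_⟩
  have b1 : |⌊u.2.1 / s⌋ * s * u.1| ≤ r * r := by
    rw [abs_mul]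
    exact mul_le_mul n2 hlt.1.le (abs_nonneg _) hr.le
  have b2 : |⌊u.1 / s⌋ * s * u.2.1| ≤ r * r := by
    rw [abs_mul]
    exact mul_le_mul m2 hlt.2.le (abs_nonneg _) hr.le
  have hrr : r ^ 2 = N ^ 2 * s ^ 2 := by rw [hrs]; ring
  have hs2 : 0 < s ^ 2 := by positivity
  rw [abs_le] at b1 b2 h3
  rw [Finset.mem_Ico, Int.le_floor, Int.floor_lt, le_div_iff₀ hs2, div_lt_iff₀ hs2]
  push_cast
  constructor <;> nlinarith

theorem hausdorffOf_ballOf_le {K : Set H} (x : K) {r : ℝ} (hr : 0 < r) :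
    hausdorffOf (fun x y : K => dbox (x : H) (y : H)) 4
      (ballOf (fun x y : K => dbox (x : H) (y : H)) x r) ≤ ENNReal.ofReal (320 * r ^ (4 : ℝ)) := by
  refine hausdorffOf_le_of_finite_covers (by norm_num) fun ε hε => ?_
  obtain ⟨N, hN, hNε⟩ : ∃ N : ℕ, 0 < N ∧ ENNReal.ofReal (2 * (r / N)) ≤ ε := by
    obtain rfl | hε' := eq_or_ne ε ⊤
    · exact ⟨1, one_pos, le_top⟩
    have he : 0 < ε.toReal := ENNReal.toReal_pos hε.ne' hε'
    obtain ⟨N, hN⟩ := exists_nat_gt (2 * r / ε.toReal)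
    have hN0 : (0 : ℝ) < N := lt_of_le_of_lt (by positivity) hN
    refine ⟨N, by exact_mod_cast hN0, ENNReal.ofReal_le_of_le_toReal ?_⟩
    rw [div_lt_iff₀ he] at hN
    rw [← mul_div_assoc, div_le_iff₀ hN0]
    linarith
  have hN' : (1 : ℝ) ≤ N := by exact_mod_cast hN
  have hs0 : 0 < r / N := by positivity
  refine ⟨ℤ × ℤ × ℤ, Finset.Ico (-N : ℤ) N ×ˢ (Finset.Ico (-N : ℤ) N ×ˢ
    Finset.Ico (-(2 * N ^ 2) : ℤ) (2 * N ^ 2 + 1)), fun g => Subtype.val ⁻¹' cell x (r / N) g,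
    ENNReal.ofReal (2 * (r / N)), ?_, ?_, hNε, ?_⟩
  · intro q hq
    obtain ⟨g, hg, hqg⟩ := exists_mem_cell hr hq hN
    exact mem_iUnion₂.2 ⟨g, hg, hqg⟩
  · intro g
    exact iSup₂_le fun p hp => iSup₂_le fun q hq =>
      ENNReal.ofReal_le_ofReal (dbox_le_of_mem_cell hs0 hp hq)
  · have hcard : (Finset.Ico (-N : ℤ) N ×ˢ (Finset.Ico (-N : ℤ) N ×ˢ
        Finset.Ico (-(2 * N ^ 2) : ℤ) (2 * N ^ 2 + 1))).card = 2 * N * (2 * N * (4 * N ^ 2 + 1)) := by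
      simp only [Finset.card_product, Int.card_Ico]
      congr 1
      · omega
      congr 1
      · omega
      · zify
        rw [Int.toNat_of_nonneg (by nlinarith [sq_nonneg (N : ℤ)])]
        ring
    rw [hcard, ENNReal.ofReal_rpow_of_nonneg (by positivity) (by norm_num), ← ENNReal.ofReal_natCast,
      ← ENNReal.ofReal_mul (by positivity), Real.rpow_ofNat, Real.rpow_ofNat]
    refine ENNReal.ofReal_le_ofReal ?_
    push_cast
    have : 2 * (N : ℝ) * (2 * N * (4 * N ^ 2 + 1)) * (2 * (r / N)) ^ 4 =
        (256 + 64 / (N : ℝ) ^ 2) * r ^ 4 := by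
      field_simp
      ring
    rw [this]
    have h64 : 64 / (N : ℝ) ^ 2 ≤ 64 := div_le_self (by norm_num) (one_le_pow₀ hN')
    gcongr
    linarith

theorem volume_le_hausdorffOf_ballOf {K : Set H}
    (hself : K = ⋃ a : Fin 2 × Fin 2 × Fin 4, Sim a '' K) {D : ℝ} (hD0 : 0 < D)
    (hD : ∀ p ∈ K, ∀ q ∈ K, dbox p q ≤ D) (x : K) {r : ℝ} (hr : 0 < r) (hrD : r ≤ D) :
    ENNReal.ofReal ((r / D) ^ 4 / 16) * volume K ≤
      8 * hausdorffOf (fun x y : K => dbox (x : H) (y : H)) 4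
        (ballOf (fun x y : K => dbox (x : H) (y : H)) x r) := by
  obtain ⟨n, hn1, hn2⟩ := exists_nat_pow_near_of_lt_one (x := r / D) (y := (1 / 2 : ℝ))
    (by positivity) ((div_le_one hD0).2 hrD) (by norm_num) (by norm_num)
  obtain ⟨A, hAK, hxA, hvol, hdiam⟩ := exists_piece hself hD (n + 1) x.2
  have hA : A ⊆ Subtype.val '' ballOf (fun x y : K => dbox (x : H) (y : H)) x r := by
    intro q hq
    refine ⟨⟨q, hAK hq⟩, ?_, rfl⟩
    rw [lt_div_iff₀ hD0] at hn1
    exact (hdiam x hxA q hq).trans_lt hn1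
  refine le_trans ?_ ((measure_mono hA).trans (volume_le_hausdorffOf _))
  rw [hvol]
  gcongr
  calc (r / D) ^ 4 / 16 ≤ ((1 / 2) ^ n) ^ 4 / 16 := by gcongr
    _ = (1 / 16) ^ (n + 1) := by
      rw [← pow_mul, mul_comm n 4, pow_mul, pow_succ]
      norm_num [div_eq_mul_inv, pow_succ]

/-- The attractor `K` of the 16 similitudes has nonempty interior and
`(K, d_b)` is Ahlfors 4-regular. -/
theorem statement17 (K : Set H) (hne : K.Nonempty) (hK : IsCompact K)
    (hself : K = ⋃ a : Fin 2 × Fin 2 × Fin 4, Sim a '' K) :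
    (interior K).Nonempty ∧
    AhlforsRegularOf (fun x y : K => dbox (x : H) (y : H)) 4 := by
  have hint : (interior K).Nonempty := by
    refine interior_nonempty_of_forall_Sim_mem hne hK fun a k hk => ?_
    rw [hself]
    exact mem_iUnion.2 ⟨a, k, hk, rfl⟩
  refine ⟨hint, ?_⟩
  obtain ⟨D, hD0, hD⟩ := exists_dbox_le hK
  have hVtop : volume K ≠ ⊤ := hK.measure_ne_top
  have hV : 0 < (volume K).toReal :=
    ENNReal.toReal_pos (Measure.measure_pos_of_nonempty_interior volume hint).ne' hVtop
  set V := (volume K).toReal with hVdef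
  refine ⟨max 320 (128 * D ^ 4 / V), le_max_of_le_left (by norm_num), fun x r hr hrd => ⟨?_, ?_⟩⟩
  · have hrD : r ≤ D := by
      have : ediamOf (fun x y : K => dbox (x : H) (y : H)) univ ≤ ENNReal.ofReal D :=
        iSup₂_le fun p _ => iSup₂_le fun q _ => ENNReal.ofReal_le_ofReal (hD p p.2 q q.2)
      exact ((ENNReal.ofReal_lt_ofReal_iff hD0).1 (hrd.trans_le this)).le
    have h := volume_le_hausdorffOf_ballOf hself hD0 hD x hr hrD
    rw [← ENNReal.ofReal_toReal hVtop, ← hVdef, ← ENNReal.ofReal_mul (by positivity),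
      ← ENNReal.div_le_iff' (by norm_num) (by norm_num)] at h
    refine le_trans ?_ h
    rw [ENNReal.le_div_iff_mul_le (by norm_num) (by norm_num), Real.rpow_ofNat]
    rw [show (8 : ℝ≥0∞) = ENNReal.ofReal 8 by norm_num, ← ENNReal.ofReal_mul (by positivity)]
    refine ENNReal.ofReal_le_ofReal ?_
    have hC : (max 320 (128 * D ^ 4 / V))⁻¹ ≤ (128 * D ^ 4 / V)⁻¹ :=
      inv_anti₀ (by positivity) (le_max_right _ _)
    calc (max 320 (128 * D ^ 4 / V))⁻¹ * r ^ 4 * 8 ≤ (128 * D ^ 4 / V)⁻¹ * r ^ 4 * 8 := by gcongr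
      _ = (r / D) ^ 4 / 16 * V := by
        field_simp
        norm_num
  · refine (hausdorffOf_ballOf_le x hr).trans (ENNReal.ofReal_le_ofReal ?_)
    have := Real.rpow_nonneg hr.le 4
    gcongr
    exact le_max_left _ _

end Heis
end
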